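/- Let M be a feasible matching in a marriage instance with critical men, and suppose some level assignment satisfies the min-size conditions for M. Then for every feasible matching N with |N| < |M| one has φ(N,M) < φ(M,N). -/

import Mathlib

open Classical

universe u v

/-- A marriage instance with critical men: a finite bipartite graph with edge set `E ⊆ A × B`,
a set `C ⊆ A` of critical men, and strict preference orders of each vertex over its
neighbours (`prefA m w w'` : man `m` strictly prefers woman `w` to woman `w'`;
`prefB w m m'` : woman `w` strictly prefers man `m` to man `m'`). -/
structure CritInstance (A : Type u) (B : Type v) where
  E : Finset (A × B)
  C : Finset A
  prefA : A → B → B → Prop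
  prefB : B → A → A → Prop
  prefA_irrefl : ∀ m w, ¬ prefA m w w
  prefA_trans : ∀ m w₁ w₂ w₃, prefA m w₁ w₂ → prefA m w₂ w₃ → prefA m w₁ w₃
  prefA_total : ∀ m w₁ w₂, (m, w₁) ∈ E → (m, w₂) ∈ E → w₁ ≠ w₂ →
    prefA m w₁ w₂ ∨ prefA m w₂ w₁
  prefB_irrefl : ∀ w m, ¬ prefB w m m
  prefB_trans : ∀ w m₁ m₂ m₃, prefB w m₁ m₂ → prefB w m₂ m₃ → prefB w m₁ m₃
  prefB_total : ∀ w m₁ m₂, (m₁, w) ∈ E → (m₂, w) ∈ E → m₁ ≠ m₂ →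
    prefB w m₁ m₂ ∨ prefB w m₂ m₁

namespace CritInstance

variable {A : Type u} {B : Type v}

/-- `M` is a matching: a set of edges in which every vertex has at most one partner. -/
def IsMatching (I : CritInstance A B) (M : Finset (A × B)) : Prop :=
  M ⊆ I.E ∧ (∀ ⦃m w w'⦄, (m, w) ∈ M → (m, w') ∈ M → w = w') ∧
    (∀ ⦃m m' w⦄, (m, w) ∈ M → (m', w) ∈ M → m = m')

/-- Man `m` is matched in `M`. -/
def ManMatched (M : Finset (A × B)) (m : A) : Prop := ∃ w, (m, w) ∈ M

/-- Woman `w` is matched in `M`. -/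
def WomanMatched (M : Finset (A × B)) (w : B) : Prop := ∃ m, (m, w) ∈ M

/-- `M` is feasible: it is a matching and every critical man is matched. -/
def IsFeasible (I : CritInstance A B) (M : Finset (A × B)) : Prop :=
  IsMatching I M ∧ ∀ m ∈ I.C, ManMatched M m

/-- Man `m` prefers matching `M` to matching `N`: he is matched in `M` and either
unmatched in `N` or strictly prefers his `M`-partner to his `N`-partner. -/
def ManPrefers (I : CritInstance A B) (M N : Finset (A × B)) (m : A) : Prop :=
  ∃ w, (m, w) ∈ M ∧ (¬ ManMatched N m ∨ ∃ w', (m, w') ∈ N ∧ I.prefA m w w')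

/-- Woman `w` prefers matching `M` to matching `N`. -/
def WomanPrefers (I : CritInstance A B) (M N : Finset (A × B)) (w : B) : Prop :=
  ∃ m, (m, w) ∈ M ∧ (¬ WomanMatched N w ∨ ∃ m', (m', w) ∈ N ∧ I.prefB w m m')

/-- `phi I M N` is the number of vertices that prefer `M` to `N`. -/
noncomputable def phi [Fintype A] [Fintype B] (I : CritInstance A B)
    (M N : Finset (A × B)) : ℕ :=
  (Finset.univ.filter fun m : A => ManPrefers I M N m).card +
    (Finset.univ.filter fun w : B => WomanPrefers I M N w).card

/-- `M` is a popular feasible matching. -/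
def IsPFM [Fintype A] [Fintype B] (I : CritInstance A B) (M : Finset (A × B)) : Prop :=
  IsFeasible I M ∧ ∀ N, IsFeasible I N → phi I N M ≤ phi I M N

/-- `M` is a minimum size popular feasible matching. -/
def IsMinPFM [Fintype A] [Fintype B] (I : CritInstance A B) (M : Finset (A × B)) : Prop :=
  IsPFM I M ∧ ∀ N, IsPFM I N → M.card ≤ N.card

/-- `M` is a dominant feasible matching. -/
def IsDFM [Fintype A] [Fintype B] (I : CritInstance A B) (M : Finset (A × B)) : Prop :=
  IsPFM I M ∧ ∀ N, IsFeasible I N → M.card < N.card → phi I N M < phi I M N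

/-- `(m,w)` is a `(+1,+1)` edge with respect to `M`: an edge of `E ∖ M` such that `m` is
unmatched or prefers `w` to his partner, and `w` is unmatched or prefers `m` to her partner. -/
def PlusPlus (I : CritInstance A B) (M : Finset (A × B)) (m : A) (w : B) : Prop :=
  (m, w) ∈ I.E ∧ (m, w) ∉ M ∧
    (¬ ManMatched M m ∨ ∃ w', (m, w') ∈ M ∧ I.prefA m w w') ∧
    (¬ WomanMatched M w ∨ ∃ m', (m', w) ∈ M ∧ I.prefB w m m')

/-- `(m,w)` is a `(−1,−1)` edge with respect to `M`: an edge of `E ∖ M` such that `m` is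
matched and prefers his partner to `w`, and `w` is matched and prefers her partner to `m`. -/
def MinusMinus (I : CritInstance A B) (M : Finset (A × B)) (m : A) (w : B) : Prop :=
  (m, w) ∈ I.E ∧ (m, w) ∉ M ∧
    (∃ w', (m, w') ∈ M ∧ I.prefA m w' w) ∧
    (∃ m', (m', w) ∈ M ∧ I.prefB w m' m)

/-- `M` is a stable matching: a matching with no blocking pair. -/
def IsStable (I : CritInstance A B) (M : Finset (A × B)) : Prop :=
  IsMatching I M ∧ ∀ m w, ¬ PlusPlus I M m w

/-- The min-size conditions for a level assignment `(lA, lB)` with respect to `M`: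
(i) matched partners share a level, unmatched vertices have level 0, non-critical men
have level 0; (ii) every `(+1,+1)` edge goes from a man to a strictly higher level woman;
(iii) every edge from a man at level `i` to a woman at level `i − 1` is a `(−1,−1)` edge;
(iv) no edge goes from a man at level `i` to a woman at level `≤ i − 2`. -/
def MinSizeConds (I : CritInstance A B) (M : Finset (A × B))
    (lA : A → ℕ) (lB : B → ℕ) : Prop :=
  (∀ m w, (m, w) ∈ M → lA m = lB w) ∧
  (∀ m, ¬ ManMatched M m → lA m = 0) ∧
  (∀ w, ¬ WomanMatched M w → lB w = 0) ∧
  (∀ m, m ∉ I.C → lA m = 0) ∧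
  (∀ m w, PlusPlus I M m w → lA m < lB w) ∧
  (∀ m w, (m, w) ∈ I.E → lB w + 1 = lA m → MinusMinus I M m w) ∧
  (∀ m w, (m, w) ∈ I.E → ¬ (lB w + 2 ≤ lA m))

/-- The dominant conditions for a level assignment `(lA, lB)` with respect to `M`:
(i) matched partners share a level, unmatched women have level 0, unmatched men have
level 1, non-critical men have level at most 1; (ii)–(iv) as in the min-size conditions. -/
def DomConds (I : CritInstance A B) (M : Finset (A × B))
    (lA : A → ℕ) (lB : B → ℕ) : Prop :=
  (∀ m w, (m, w) ∈ M → lA m = lB w) ∧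
  (∀ m, ¬ ManMatched M m → lA m = 1) ∧
  (∀ w, ¬ WomanMatched M w → lB w = 0) ∧
  (∀ m, m ∉ I.C → lA m ≤ 1) ∧
  (∀ m w, PlusPlus I M m w → lA m < lB w) ∧
  (∀ m w, (m, w) ∈ I.E → lB w + 1 = lA m → MinusMinus I M m w) ∧
  (∀ m w, (m, w) ∈ I.E → ¬ (lB w + 2 ≤ lA m))

/-- Adjacency in the bipartite graph, on the vertex set `A ⊕ B`. -/
def Adj (I : CritInstance A B) : A ⊕ B → A ⊕ B → Prop
  | Sum.inl m, Sum.inr w => (m, w) ∈ I.E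
  | Sum.inr w, Sum.inl m => (m, w) ∈ I.E
  | _, _ => False

/-- The (directed) pair `(u, v)` of vertices spans an edge of the matching `M`. -/
def StepM (M : Finset (A × B)) : A ⊕ B → A ⊕ B → Prop
  | Sum.inl m, Sum.inr w => (m, w) ∈ M
  | Sum.inr w, Sum.inl m => (m, w) ∈ M
  | _, _ => False

/-- The pair `(u, v)` of vertices spans a `(+1,+1)` edge with respect to `M`. -/
def StepPP (I : CritInstance A B) (M : Finset (A × B)) : A ⊕ B → A ⊕ B → Prop
  | Sum.inl m, Sum.inr w => PlusPlus I M m w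
  | Sum.inr w, Sum.inl m => PlusPlus I M m w
  | _, _ => False

/-- The pair `(u, v)` of vertices spans a `(−1,−1)` edge with respect to `M`. -/
def StepMM (I : CritInstance A B) (M : Finset (A × B)) : A ⊕ B → A ⊕ B → Prop
  | Sum.inl m, Sum.inr w => MinusMinus I M m w
  | Sum.inr w, Sum.inl m => MinusMinus I M m w
  | _, _ => False

/-- A vertex of `A ⊕ B` is matched in `M`. -/
def VMatched (M : Finset (A × B)) : A ⊕ B → Prop
  | Sum.inl m => ManMatched M m
  | Sum.inr w => WomanMatched M w

/-- An `M`-alternating path in the graph: a sequence of distinct vertices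
`vert 0, …, vert len` (`len ≥ 1` edges), consecutive vertices adjacent, with
consecutive edges alternately inside and outside `M`. -/
structure AltPath (I : CritInstance A B) (M : Finset (A × B)) where
  len : ℕ
  len_pos : 0 < len
  vert : ℕ → A ⊕ B
  inj : ∀ i j, i ≤ len → j ≤ len → vert i = vert j → i = j
  adj : ∀ i, i < len → Adj I (vert i) (vert (i + 1))
  alternate : ∀ i, i + 1 < len →
    (StepM M (vert i) (vert (i + 1)) ↔ ¬ StepM M (vert (i + 1)) (vert (i + 2)))

namespace AltPath

variable {I : CritInstance A B} {M : Finset (A × B)}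

/-- The number of `(+1,+1)` edges of the path. -/
noncomputable def countPP (ρ : AltPath I M) : ℕ :=
  ((Finset.range ρ.len).filter fun i => StepPP I M (ρ.vert i) (ρ.vert (i + 1))).card

/-- The number of `(−1,−1)` edges of the path. -/
noncomputable def countMM (ρ : AltPath I M) : ℕ :=
  ((Finset.range ρ.len).filter fun i => StepMM I M (ρ.vert i) (ρ.vert (i + 1))).card

/-- The vertex `u` lies on the path. -/
def Mem (ρ : AltPath I M) (u : A ⊕ B) : Prop := ∃ i ≤ ρ.len, ρ.vert i = u

/-- The set of edges of the path, as a set of pairs in `A × B`. -/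
noncomputable def edges (ρ : AltPath I M) : Finset (A × B) :=
  I.E.filter fun e => ∃ i < ρ.len,
    (ρ.vert i = Sum.inl e.1 ∧ ρ.vert (i + 1) = Sum.inr e.2) ∨
    (ρ.vert i = Sum.inr e.2 ∧ ρ.vert (i + 1) = Sum.inl e.1)

end AltPath

/-- An `M`-alternating cycle: a closed sequence of vertices `vert 0, …, vert len = vert 0`
(distinct except for the return), consecutive vertices adjacent, with edges alternately
inside and outside `M`, including around the wrap. -/
structure AltCycle (I : CritInstance A B) (M : Finset (A × B)) where
  len : ℕ
  len_pos : 0 < len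
  vert : ℕ → A ⊕ B
  closed : vert len = vert 0
  inj : ∀ i j, i < len → j < len → vert i = vert j → i = j
  adj : ∀ i, i < len → Adj I (vert i) (vert (i + 1))
  alternate : ∀ i, i + 1 < len →
    (StepM M (vert i) (vert (i + 1)) ↔ ¬ StepM M (vert (i + 1)) (vert (i + 2)))
  alternate_wrap : StepM M (vert (len - 1)) (vert len) ↔ ¬ StepM M (vert 0) (vert 1)

namespace AltCycle

variable {I : CritInstance A B} {M : Finset (A × B)}

/-- The number of `(+1,+1)` edges of the cycle. -/
noncomputable def countPP (σ : AltCycle I M) : ℕ :=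
  ((Finset.range σ.len).filter fun i => StepPP I M (σ.vert i) (σ.vert (i + 1))).card

/-- The number of `(−1,−1)` edges of the cycle. -/
noncomputable def countMM (σ : AltCycle I M) : ℕ :=
  ((Finset.range σ.len).filter fun i => StepMM I M (σ.vert i) (σ.vert (i + 1))).card

end AltCycle

/-- A size-increasing alternating path (SIAP) for `M`: an `M`-alternating path whose two
endpoints are a man unmatched in `M` and a woman unmatched in `M`, and which has equally
many `(+1,+1)` and `(−1,−1)` edges. -/
def IsSIAP (I : CritInstance A B) (M : Finset (A × B)) (ρ : AltPath I M) : Prop :=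
  (((∃ m, ρ.vert 0 = Sum.inl m ∧ ¬ ManMatched M m) ∧
      (∃ w, ρ.vert ρ.len = Sum.inr w ∧ ¬ WomanMatched M w)) ∨
    ((∃ w, ρ.vert 0 = Sum.inr w ∧ ¬ WomanMatched M w) ∧
      (∃ m, ρ.vert ρ.len = Sum.inl m ∧ ¬ ManMatched M m))) ∧
  ρ.countPP = ρ.countMM

/-- A size-reducing alternating path (SRAP) for `M` with respect to the level assignment
`(lA, lB)`: an `M`-alternating path both of whose terminal edges lie in `M`, starting at a
woman matched in `M` at level 0, ending at a non-critical man at level 1, whose number of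
`(+1,+1)` edges is exactly one more than its number of `(−1,−1)` edges. -/
def IsSRAP (I : CritInstance A B) (M : Finset (A × B)) (lA : A → ℕ) (lB : B → ℕ)
    (ρ : AltPath I M) : Prop :=
  StepM M (ρ.vert 0) (ρ.vert 1) ∧
  StepM M (ρ.vert (ρ.len - 1)) (ρ.vert ρ.len) ∧
  (((∃ w, ρ.vert 0 = Sum.inr w ∧ WomanMatched M w ∧ lB w = 0) ∧
      (∃ m, ρ.vert ρ.len = Sum.inl m ∧ m ∉ I.C ∧ lA m = 1)) ∨
    ((∃ m, ρ.vert 0 = Sum.inl m ∧ m ∉ I.C ∧ lA m = 1) ∧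
      (∃ w, ρ.vert ρ.len = Sum.inr w ∧ WomanMatched M w ∧ lB w = 0))) ∧
  ρ.countPP = ρ.countMM + 1

end CritInstance

namespace CritInstance

variable {A : Type u} {B : Type v} {I : CritInstance A B} {M N : Finset (A × B)}

/-- The vote of man `m` in the election between `N` and `M`: `1` for `N`, `-1` for `M`. -/
noncomputable def voteA (I : CritInstance A B) (N M : Finset (A × B)) (m : A) : ℤ :=
  (if ManPrefers I N M m then 1 else 0) - (if ManPrefers I M N m then 1 else 0)

/-- The vote of woman `w` in the election between `N` and `M`: `1` for `N`, `-1` for `M`. -/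
noncomputable def voteB (I : CritInstance A B) (N M : Finset (A × B)) (w : B) : ℤ :=
  (if WomanPrefers I N M w then 1 else 0) - (if WomanPrefers I M N w then 1 else 0)

theorem voteA_le_one (m : A) : voteA I N M m ≤ 1 := by
  unfold voteA; split_ifs <;> norm_num

theorem voteB_le_one (w : B) : voteB I N M w ≤ 1 := by
  unfold voteB; split_ifs <;> norm_num

theorem voteA_nonpos_of_not_manMatched {m : A} (hm : ¬ ManMatched N m) :
    voteA I N M m ≤ 0 := by
  have : ¬ ManPrefers I N M m := fun ⟨w, hw, _⟩ => hm ⟨w, hw⟩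
  unfold voteA; rw [if_neg this]; split_ifs <;> norm_num

theorem voteB_nonpos_of_not_womanMatched {w : B} (hw : ¬ WomanMatched N w) :
    voteB I N M w ≤ 0 := by
  have : ¬ WomanPrefers I N M w := fun ⟨m, hm, _⟩ => hw ⟨m, hm⟩
  unfold voteB; rw [if_neg this]; split_ifs <;> norm_num

theorem voteA_eq_neg_one_of_not_manMatched {m : A} (hN : ¬ ManMatched N m)
    (hM : ManMatched M m) : voteA I N M m = -1 := by
  have h₁ : ¬ ManPrefers I N M m := fun ⟨w, hw, _⟩ => hN ⟨w, hw⟩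
  have h₂ : ManPrefers I M N m := hM.imp fun _ hw => ⟨hw, .inl hN⟩
  simp [voteA, h₁, h₂]

theorem IsMatching.manPrefers_iff (hN : IsMatching I N) {m : A} {w : B} (hw : (m, w) ∈ N) :
    ManPrefers I N M m ↔ (¬ ManMatched M m ∨ ∃ w', (m, w') ∈ M ∧ I.prefA m w w') := by
  refine ⟨fun ⟨w₁, h₁, h₂⟩ => ?_, fun h => ⟨w, hw, h⟩⟩
  obtain rfl := hN.2.1 hw h₁
  exact h₂

theorem IsMatching.womanPrefers_iff (hN : IsMatching I N) {m : A} {w : B} (hw : (m, w) ∈ N) :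
    WomanPrefers I N M w ↔ (¬ WomanMatched M w ∨ ∃ m', (m', w) ∈ M ∧ I.prefB w m m') := by
  refine ⟨fun ⟨m₁, h₁, h₂⟩ => ?_, fun h => ⟨m, hw, h⟩⟩
  obtain rfl := hN.2.2 hw h₁
  exact h₂

theorem IsMatching.voteA_eq_zero (hN : IsMatching I N) (hM : IsMatching I M) {m : A} {w : B}
    (hwN : (m, w) ∈ N) (hwM : (m, w) ∈ M) : voteA I N M m = 0 := by
  have key {P Q : Finset (A × B)} (hP : IsMatching I P) (hQ : IsMatching I Q)
      (hwP : (m, w) ∈ P) (hwQ : (m, w) ∈ Q) : ¬ ManPrefers I P Q m := by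
    rw [hP.manPrefers_iff hwP]
    rintro (h | ⟨w', hw', h⟩)
    · exact h ⟨w, hwQ⟩
    · obtain rfl := hQ.2.1 hwQ hw'
      exact I.prefA_irrefl _ _ h
  simp [voteA, key hN hM hwN hwM, key hM hN hwM hwN]

theorem IsMatching.voteB_eq_zero (hN : IsMatching I N) (hM : IsMatching I M) {m : A} {w : B}
    (hwN : (m, w) ∈ N) (hwM : (m, w) ∈ M) : voteB I N M w = 0 := by
  have key {P Q : Finset (A × B)} (hP : IsMatching I P) (hQ : IsMatching I Q)
      (hwP : (m, w) ∈ P) (hwQ : (m, w) ∈ Q) : ¬ WomanPrefers I P Q w := by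
    rw [hP.womanPrefers_iff hwP]
    rintro (h | ⟨m', hm', h⟩)
    · exact h ⟨m, hwQ⟩
    · obtain rfl := hQ.2.2 hwQ hm'
      exact I.prefB_irrefl _ _ h
  simp [voteB, key hN hM hwN hwM, key hM hN hwM hwN]

theorem IsMatching.voteA_eq_neg_one (hN : IsMatching I N) (hM : IsMatching I M) {m : A}
    {w w' : B} (hw : (m, w) ∈ N) (hw' : (m, w') ∈ M) (hp : I.prefA m w' w) :
    voteA I N M m = -1 := by
  have h₁ : ManPrefers I M N m := ⟨w', hw', .inr ⟨w, hw, hp⟩⟩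
  have h₂ : ¬ ManPrefers I N M m := by
    rw [hN.manPrefers_iff hw]
    rintro (h | ⟨w₁, hw₁, h⟩)
    · exact h ⟨w', hw'⟩
    · obtain rfl := hM.2.1 hw' hw₁
      exact I.prefA_irrefl _ _ (I.prefA_trans _ _ _ _ h hp)
  simp [voteA, h₁, h₂]

theorem IsMatching.voteB_eq_neg_one (hN : IsMatching I N) (hM : IsMatching I M) {m m' : A}
    {w : B} (hm : (m, w) ∈ N) (hm' : (m', w) ∈ M) (hp : I.prefB w m' m) :
    voteB I N M w = -1 := by
  have h₁ : WomanPrefers I M N w := ⟨m', hm', .inr ⟨m, hm, hp⟩⟩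
  have h₂ : ¬ WomanPrefers I N M w := by
    rw [hN.womanPrefers_iff hm]
    rintro (h | ⟨m₁, hm₁, h⟩)
    · exact h ⟨m', hm'⟩
    · obtain rfl := hM.2.2 hm' hm₁
      exact I.prefB_irrefl _ _ (I.prefB_trans _ _ _ _ h hp)
  simp [voteB, h₁, h₂]

theorem IsMatching.voteA_add_voteB_nonpos (hN : IsMatching I N) (hM : IsMatching I M)
    {m : A} {w : B} (hw : (m, w) ∈ N) (hwM : (m, w) ∉ M) (hpp : ¬ PlusPlus I M m w) :
    voteA I N M m + voteB I N M w ≤ 0 := by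
  by_cases hA : ¬ ManMatched M m ∨ ∃ w', (m, w') ∈ M ∧ I.prefA m w w'
  · have hB : ¬ (¬ WomanMatched M w ∨ ∃ m', (m', w) ∈ M ∧ I.prefB w m m') :=
      fun hB => hpp ⟨hN.1 hw, hwM, hA, hB⟩
    simp only [not_or, not_not, not_exists, not_and] at hB
    obtain ⟨⟨m', hm'⟩, hB⟩ := hB
    have hne : m ≠ m' := by rintro rfl; exact hwM hm'
    have hp := (I.prefB_total w m m' (hN.1 hw) (hM.1 hm') hne).resolve_left (hB m' hm')
    linarith [hN.voteB_eq_neg_one hM hw hm' hp, voteA_le_one (I := I) (N := N) (M := M) m]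
  · simp only [not_or, not_not, not_exists, not_and] at hA
    obtain ⟨⟨w', hw'⟩, hA⟩ := hA
    have hne : w ≠ w' := by rintro rfl; exact hwM hw'
    have hp := (I.prefA_total m w w' (hN.1 hw) (hM.1 hw') hne).resolve_left (hA w' hw')
    linarith [hN.voteA_eq_neg_one hM hw hw' hp, voteB_le_one (I := I) (N := N) (M := M) w]

/-- The level assignment is a dual certificate: the votes across an edge of `N` are bounded by
twice the level difference. -/
theorem MinSizeConds.vote_le {lA : A → ℕ} {lB : B → ℕ} (h : MinSizeConds I M lA lB)
    (hN : IsMatching I N) (hM : IsMatching I M) {m : A} {w : B} (hw : (m, w) ∈ N) :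
    voteA I N M m + voteB I N M w ≤ 2 * lB w - 2 * lA m := by
  obtain ⟨hl, -, -, -, hpp, hmm, hsteep⟩ := h
  by_cases hwM : (m, w) ∈ M
  · have := hl m w hwM
    rw [hN.voteA_eq_zero hM hw hwM, hN.voteB_eq_zero hM hw hwM]
    omega
  rcases lt_trichotomy (lA m) (lB w) with hlt | heq | hgt
  · have := voteA_le_one (I := I) (N := N) (M := M) m
    have := voteB_le_one (I := I) (N := N) (M := M) w
    omega
  · have := hN.voteA_add_voteB_nonpos hM hw hwM fun hp => (hpp m w hp).ne heq
    omega
  · have hs := hsteep m w (hN.1 hw)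
    obtain ⟨-, -, ⟨w', hw', hpA⟩, m', hm', hpB⟩ := hmm m w (hN.1 hw) (by omega)
    have := hN.voteA_eq_neg_one hM hw hw' hpA
    have := hN.voteB_eq_neg_one hM hw hm' hpB
    omega

theorem mem_image_fst {m : A} : m ∈ M.image Prod.fst ↔ ManMatched M m := by
  simp [ManMatched]

theorem mem_image_snd {w : B} : w ∈ M.image Prod.snd ↔ WomanMatched M w := by
  simp [WomanMatched]

theorem IsMatching.injOn_fst (hM : IsMatching I M) : Set.InjOn Prod.fst (M : Set (A × B)) := by
  rintro ⟨m, w⟩ h ⟨m', w'⟩ h' (rfl : m = m')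
  rw [hM.2.1 h h']

theorem IsMatching.injOn_snd (hM : IsMatching I M) : Set.InjOn Prod.snd (M : Set (A × B)) := by
  rintro ⟨m, w⟩ h ⟨m', w'⟩ h' (rfl : w = w')
  rw [hM.2.2 h h']

theorem IsMatching.sum_man [Fintype A] (hM : IsMatching I M) (f : A → ℤ) :
    ∑ m, f m = ∑ e ∈ M, f e.1 + ∑ m ∈ (M.image Prod.fst)ᶜ, f m := by
  rw [← Finset.sum_add_sum_compl (M.image Prod.fst), Finset.sum_image hM.injOn_fst]

theorem IsMatching.sum_woman [Fintype B] (hM : IsMatching I M) (f : B → ℤ) :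
    ∑ w, f w = ∑ e ∈ M, f e.2 + ∑ w ∈ (M.image Prod.snd)ᶜ, f w := by
  rw [← Finset.sum_add_sum_compl (M.image Prod.snd), Finset.sum_image hM.injOn_snd]

theorem MinSizeConds.sum_level_eq [Fintype A] [Fintype B] {lA : A → ℕ} {lB : B → ℕ}
    (h : MinSizeConds I M lA lB) (hM : IsMatching I M) :
    ∑ m, (lA m : ℤ) = ∑ w, (lB w : ℤ) := by
  obtain ⟨hl, hA, hB, -⟩ := h
  rw [hM.sum_man, hM.sum_woman]
  congr 1
  · exact Finset.sum_congr rfl fun e he => by rw [hl e.1 e.2 he]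
  · rw [Finset.sum_eq_zero, Finset.sum_eq_zero]
    · intro w hw
      rw [Finset.mem_compl, mem_image_snd] at hw
      simp [hB w hw]
    · intro m hm
      rw [Finset.mem_compl, mem_image_fst] at hm
      simp [hA m hm]

theorem phi_sub_phi [Fintype A] [Fintype B] :
    (phi I N M : ℤ) - phi I M N = ∑ m, voteA I N M m + ∑ w, voteB I N M w := by
  simp only [phi, voteA, voteB, Finset.sum_sub_distrib, Finset.sum_boole]
  push_cast
  ring

theorem IsMatching.exists_manMatched_not_manMatched (hN : IsMatching I N) (hM : IsMatching I M)
    (hlt : N.card < M.card) : ∃ m, ManMatched M m ∧ ¬ ManMatched N m := by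
  rw [← Finset.card_image_of_injOn hN.injOn_fst, ← Finset.card_image_of_injOn hM.injOn_fst] at hlt
  obtain ⟨m, hm, hm'⟩ := Finset.exists_mem_notMem_of_card_lt_card hlt
  exact ⟨m, mem_image_fst.1 hm, fun h => hm' (mem_image_fst.2 h)⟩

end CritInstance

/-- If `M` is a feasible matching and some level assignment satisfies the
min-size conditions for `M`, then `φ(N,M) < φ(M,N)` for every feasible matching `N` with
`|N| < |M|`. -/
theorem minSizeConds_beats_smaller {A : Type u} {B : Type v} [Fintype A] [Fintype B]
    (I : CritInstance A B) (M : Finset (A × B)) (hM : I.IsFeasible M)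
    (lA : A → ℕ) (lB : B → ℕ) (h : I.MinSizeConds M lA lB) :
    ∀ N, I.IsFeasible N → N.card < M.card → I.phi N M < I.phi M N := by
  intro N hN hlt
  have hedge : ∑ e ∈ N, ((I.voteA N M e.1 + 2 * lA e.1) + (I.voteB N M e.2 - 2 * lB e.2)) ≤ 0 :=
    Finset.sum_nonpos fun e he => by
      have := h.vote_le hN.1 hM.1 (m := e.1) (w := e.2) he
      linarith
  have hmen : ∑ m ∈ (N.image Prod.fst)ᶜ, (I.voteA N M m + 2 * lA m) < 0 := by
    have hcompl {m : A} (hm : ¬ CritInstance.ManMatched N m) :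
        I.voteA N M m + 2 * lA m = I.voteA N M m := by
      simp [h.2.2.2.1 m fun hC => hm (hN.2 m hC)]
    obtain ⟨m, hmM, hmN⟩ := hN.1.exists_manMatched_not_manMatched hM.1 hlt
    refine Finset.sum_neg' (fun m hm => ?_) ⟨m, ?_, ?_⟩
    · rw [Finset.mem_compl, CritInstance.mem_image_fst] at hm
      rw [hcompl hm]
      exact CritInstance.voteA_nonpos_of_not_manMatched hm
    · rwa [Finset.mem_compl, CritInstance.mem_image_fst]
    · rw [hcompl hmN, CritInstance.voteA_eq_neg_one_of_not_manMatched hmN hmM]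
      norm_num
  have hwomen : ∑ w ∈ (N.image Prod.snd)ᶜ, (I.voteB N M w - 2 * lB w) ≤ 0 := by
    refine Finset.sum_nonpos fun w hw => ?_
    rw [Finset.mem_compl, CritInstance.mem_image_snd] at hw
    have := CritInstance.voteB_nonpos_of_not_womanMatched (I := I) (M := M) hw
    omega
  have hA := hN.1.sum_man fun m => I.voteA N M m + 2 * lA m
  have hB := hN.1.sum_woman fun w => I.voteB N M w - 2 * lB w
  rw [Finset.sum_add_distrib] at hedge
  rw [Finset.sum_add_distrib, ← Finset.mul_sum] at hA
  rw [Finset.sum_sub_distrib, ← Finset.mul_sum] at hB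
  have hphi := CritInstance.phi_sub_phi (I := I) (N := N) (M := M)
  have hlevel := h.sum_level_eq hM.1
  have : (I.phi N M : ℤ) < I.phi M N := by linarith
  exact_mod_cast this
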